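/- Let n ≥ 2, let a < b be real numbers with b ≤ b_max for a known constant b_max, and let α ∈ (0, 1). Let X₁, …, Xₙ be independent random variables, each uniformly distributed on the interval [a, b], with m = min{X₁, …, Xₙ} and M = max{X₁, …, Xₙ}. Then the clipped estimator b̂' = min( b_max, m + (M − m)/α^(1/(n−1)) ) satisfies: the probability of the event { b ≤ b̂' } is at least 1 − α. -/

import Mathlib

open MeasureTheory ProbabilityTheory Set

lemma aux_set_meas (k : ℕ) (t b : ℝ) :
    MeasurableSet {p : ℝ × (Fin k → ℝ) | ∀ j, p.1 ≤ p.2 j ∧ p.2 j < p.1 + t * (b - p.1)} := by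
  rw [ofPred_forall]
  refine MeasurableSet.iInter fun j => ?_
  have h1 : MeasurableSet {p : ℝ × (Fin k → ℝ) | p.1 ≤ p.2 j} :=
    measurableSet_le (by fun_prop) (by fun_prop)
  have h2 : MeasurableSet {p : ℝ × (Fin k → ℝ) | p.2 j < p.1 + t * (b - p.1)} :=
    measurableSet_lt (by fun_prop) (by fun_prop)
  exact h1.inter h2

lemma aux_integral (k : ℕ) (t a b : ℝ) (hab : a < b) :
    ∫ x in a..b, (t * (b - x) / (b - a)) ^ k = t ^ k * (b - a) / (k + 1) := by
  have h0 : b - a ≠ 0 := (sub_pos.2 hab).ne'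
  have h1 : ∀ x, (t * (b - x) / (b - a)) ^ k = (t / (b - a)) ^ k * (b - x) ^ k := by
    intro x; rw [← mul_pow]; congr 1; ring
  simp_rw [h1]
  rw [intervalIntegral.integral_const_mul,
    intervalIntegral.integral_comp_sub_left (fun x => x ^ k) b, integral_pow]
  simp only [sub_self, div_pow]
  rw [zero_pow (Nat.succ_ne_zero k), pow_succ]
  field_simp
  ring

lemma aux_prod (k : ℕ) (t a b : ℝ) (hab : a < b) (ht : 0 ≤ t) (ν : Measure ℝ)
    [IsProbabilityMeasure ν]
    (hν : ν = (ENNReal.ofReal (b - a))⁻¹ • volume.restrict (Icc a b)) :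
    (ν.prod (Measure.pi fun _ : Fin k => ν))
      {p : ℝ × (Fin k → ℝ) | ∀ j, p.1 ≤ p.2 j ∧ p.2 j < p.1 + t * (b - p.1)}
      ≤ ENNReal.ofReal (t ^ k / (k + 1)) := by
  have hba : 0 < b - a := sub_pos.2 hab
  rw [Measure.prod_apply (aux_set_meas k t b)]
  have h1 : ∀ x, (Measure.pi fun _ : Fin k => ν) (Prod.mk x ⁻¹'
      {p : ℝ × (Fin k → ℝ) | ∀ j, p.1 ≤ p.2 j ∧ p.2 j < p.1 + t * (b - p.1)})
      = (ν (Ico x (x + t * (b - x)))) ^ k := by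
    intro x
    have : (Prod.mk x ⁻¹'
      {p : ℝ × (Fin k → ℝ) | ∀ j, p.1 ≤ p.2 j ∧ p.2 j < p.1 + t * (b - p.1)})
      = Set.pi univ fun _ : Fin k => Ico x (x + t * (b - x)) := by
      ext y; simp
    rw [this, Measure.pi_pi]; simp
  simp_rw [h1]
  have h2 : ∀ x ∈ Icc a b, (ν (Ico x (x + t * (b - x)))) ^ k ≤
      ENNReal.ofReal ((t * (b - x) / (b - a)) ^ k) := by
    intro x hx
    have hx0 : 0 ≤ t * (b - x) := mul_nonneg ht (sub_nonneg.2 hx.2)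
    rw [ENNReal.ofReal_pow (div_nonneg hx0 hba.le)]
    gcongr
    rw [hν, Measure.smul_apply, smul_eq_mul, ENNReal.ofReal_div_of_pos hba, ENNReal.div_eq_inv_mul]
    gcongr
    refine (Measure.restrict_apply_le _ _).trans ?_
    rw [Real.volume_Ico]
    simp
  calc _ = (ENNReal.ofReal (b - a))⁻¹ * ∫⁻ x in Icc a b, (ν (Ico x (x + t * (b - x)))) ^ k := by
        conv_lhs => rw [hν]
        rw [lintegral_smul_measure, smul_eq_mul, ← hν]
    _ ≤ (ENNReal.ofReal (b - a))⁻¹ * ∫⁻ x in Icc a b,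
          ENNReal.ofReal ((t * (b - x) / (b - a)) ^ k) := by
        refine mul_le_mul_right ?_ _
        exact setLIntegral_mono' measurableSet_Icc h2
    _ = ENNReal.ofReal (t ^ k / (k + 1)) := by
        rw [← ofReal_integral_eq_lintegral_ofReal]
        · rw [integral_Icc_eq_integral_Ioc, ← intervalIntegral.integral_of_le hab.le,
            aux_integral k t a b hab, ← ENNReal.div_eq_inv_mul, ← ENNReal.ofReal_div_of_pos hba]
          congr 1
          field_simp
        · exact Continuous.integrableOn_Icc (by fun_prop)
        · filter_upwards [ae_restrict_mem measurableSet_Icc] with x hx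
          exact pow_nonneg (div_nonneg (mul_nonneg ht (sub_nonneg.2 hx.2)) hba.le) _

lemma aux_Fi {Ω : Type*} [MeasurableSpace Ω] (μ : Measure Ω) [IsProbabilityMeasure μ]
    (k : ℕ) (a b t : ℝ) (hab : a < b) (ht : 0 ≤ t)
    (X : Fin (k + 1) → Ω → ℝ) (hmeas : ∀ i, Measurable (X i))
    (hindep : iIndepFun X μ)
    (hunif : ∀ i, Measure.map (X i) μ =
      (ENNReal.ofReal (b - a))⁻¹ • volume.restrict (Icc a b)) (i : Fin (k + 1)) :
    μ {ω | ∀ j : Fin k, X i ω ≤ X (i.succAbove j) ω ∧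
      X (i.succAbove j) ω < X i ω + t * (b - X i ω)} ≤ ENNReal.ofReal (t ^ k / (k + 1)) := by
  obtain ⟨ν, hν⟩ : ∃ ν, ν = (ENNReal.ofReal (b - a))⁻¹ • volume.restrict (Icc a b) := ⟨_, rfl⟩
  rw [← hν] at hunif
  have : IsProbabilityMeasure ν := by
    rw [← hunif i]; exact Measure.isProbabilityMeasure_map (hmeas i).aemeasurable
  have hjoint : Measure.map (fun ω i => X i ω) μ = Measure.pi fun _ => ν := by
    rw [(iIndepFun_iff_map_fun_eq_pi_map fun i => (hmeas i).aemeasurable).1 hindep]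
    simp_rw [hunif]
  have hmp := measurePreserving_piFinSuccAbove (fun _ : Fin (k + 1) => ν) i
  have hX : Measurable (fun ω i => X i ω) := measurable_pi_lambda _ hmeas
  refine le_trans (le_of_eq ?_) (aux_prod k t a b hab ht ν hν)
  rw [← hmp.measure_preimage (aux_set_meas k t b).nullMeasurableSet, ← hjoint,
    Measure.map_apply hX (hmp.measurable (aux_set_meas k t b))]
  rfl

/-- For `n ≥ 2` i.i.d. samples uniform on `[a, b]` (`a < b ≤ b_max`)
and `α ∈ (0, 1)`, with `m = min i, X i` and `M = max i, X i`, the clipped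
estimator `b̂' = min(b_max, m + (M - m)/α^(1/(n-1)))` satisfies
`P(b ≤ b̂') ≥ 1 - α`. -/
theorem uniform_clipped_upper_confidence_bound
    {Ω : Type*} [MeasurableSpace Ω] (μ : Measure Ω) [IsProbabilityMeasure μ]
    (n : ℕ) (hn : 2 ≤ n) (a b bmax : ℝ) (hab : a < b) (hbmax : b ≤ bmax)
    (α : ℝ) (hα : α ∈ Ioo (0 : ℝ) 1)
    (X : Fin n → Ω → ℝ) (hmeas : ∀ i, Measurable (X i))
    (hindep : iIndepFun X μ)
    (hunif : ∀ i, Measure.map (X i) μ =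
      (ENNReal.ofReal (b - a))⁻¹ • volume.restrict (Icc a b)) :
    ENNReal.ofReal (1 - α) ≤
      μ {ω | b ≤ min bmax ((⨅ i, X i ω) +
        ((⨆ i, X i ω) - ⨅ i, X i ω) / α ^ ((1 : ℝ) / ((n : ℝ) - 1)))} := by
  obtain ⟨k, rfl⟩ : ∃ k, n = k + 1 := ⟨n - 1, by omega⟩
  have hk : k ≠ 0 := by omega
  obtain ⟨t, htdef⟩ : ∃ t, t = α ^ ((1 : ℝ) / (((k + 1 : ℕ) : ℝ) - 1)) := ⟨_, rfl⟩
  have ht : 0 < t := htdef ▸ Real.rpow_pos_of_pos hα.1 _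
  have htk : t ^ k = α := by
    rw [htdef]
    push_cast
    rw [add_sub_cancel_right, one_div, Real.rpow_inv_natCast_pow hα.1.le hk]
  rw [← htdef]
  set S := {ω | b ≤ min bmax ((⨅ i, X i ω) + ((⨆ i, X i ω) - ⨅ i, X i ω) / t)} with hS
  have hsub : Sᶜ ⊆ ⋃ i, {ω | ∀ j : Fin k, X i ω ≤ X (i.succAbove j) ω ∧
      X (i.succAbove j) ω < X i ω + t * (b - X i ω)} := by
    intro ω hω
    obtain ⟨i, hi⟩ := exists_eq_ciInf_of_finite (f := fun i => X i ω)
    rw [mem_iUnion]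
    refine ⟨i, fun j => ?_⟩
    have hlt : (⨅ i, X i ω) + ((⨆ i, X i ω) - ⨅ i, X i ω) / t < b := by
      by_contra h
      exact hω (le_min hbmax (not_lt.1 h))
    have hle : X (i.succAbove j) ω ≤ ⨆ i, X i ω :=
      le_ciSup (f := fun i => X i ω) (Set.finite_range _).bddAbove _
    have hge : (⨅ i, X i ω) ≤ X (i.succAbove j) ω :=
      ciInf_le (f := fun i => X i ω) (Set.finite_range _).bddBelow _
    rw [← hi] at hlt hge
    have h3 : ((⨆ i, X i ω) - X i ω) / t < b - X i ω := by
      linarith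
    rw [div_lt_iff₀ ht] at h3
    exact ⟨hge, by linarith⟩
  have hSc : μ Sᶜ ≤ ENNReal.ofReal α := by
    refine (measure_mono hsub).trans ((measure_iUnion_le _).trans ?_)
    rw [tsum_fintype]
    refine (Finset.sum_le_sum fun i _ =>
      aux_Fi μ k a b t hab ht.le X hmeas hindep hunif i).trans (le_of_eq ?_)
    rw [htk, ← ENNReal.ofReal_sum_of_nonneg fun _ _ => div_nonneg hα.1.le (by positivity)]
    congr 1
    simp
    field_simp
  have h1 : (1 : ENNReal) ≤ μ S + μ Sᶜ := by
    rw [← measure_univ (μ := μ), ← union_compl_self S]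
    exact measure_union_le _ _
  rw [ENNReal.ofReal_sub _ hα.1.le, ENNReal.ofReal_one, tsub_le_iff_right]
  exact h1.trans (by gcongr)
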